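/- Let G be an unsatisfiable CNF formula, F ⊆ G a factor of G with basis C. Then G has a resolution refutation of length at most h(F[¬C]) + h({C} ∪ (G \ F)) − 1, where h denotes resolution hardness and F[¬C] is the restriction of F by the assignment setting all literals of C to 0. -/

import Mathlib

/-- A literal: a variable (natural number) with a polarity. -/
abbrev Lit : Type := ℕ × Bool

/-- Negation of a literal. -/
def Lit.neg (ℓ : Lit) : Lit := (ℓ.1, !ℓ.2)

/-- A clause: a finite set of literals. -/
abbrev Clause : Type := Finset Lit

/-- A clause is non-tautological: it contains no literal together with its negation. -/
def Clause.NonTaut (C : Clause) : Prop := ∀ ℓ ∈ C, Lit.neg ℓ ∉ C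

/-- A CNF formula: a finite set of clauses. -/
abbrev CNF : Type := Finset Clause

/-- A CNF formula is well-formed if all of its clauses are non-tautological. -/
def CNF.WellFormed (F : CNF) : Prop := ∀ C ∈ F, C.NonTaut

/-- A (total) assignment `τ` satisfies a literal. -/
def SatLit (τ : ℕ → Bool) (ℓ : Lit) : Prop := τ ℓ.1 = ℓ.2

/-- An assignment satisfies a clause if it satisfies some literal of it. -/
def SatClause (τ : ℕ → Bool) (C : Clause) : Prop := ∃ ℓ ∈ C, SatLit τ ℓ

/-- An assignment satisfies a CNF formula if it satisfies all of its clauses. -/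
def SatCNF (τ : ℕ → Bool) (F : CNF) : Prop := ∀ C ∈ F, SatClause τ C

/-- A CNF formula is unsatisfiable if no assignment satisfies it. -/
def Unsat (F : CNF) : Prop := ¬ ∃ τ : ℕ → Bool, SatCNF τ F

/-- `F` entails `G`: every model of `F` is a model of `G`. -/
def Entails (F G : CNF) : Prop := ∀ τ : ℕ → Bool, SatCNF τ F → SatCNF τ G

/-- Logical equivalence of CNF formulas. -/
def Equivalent (F G : CNF) : Prop := Entails F G ∧ Entails G F

/-- Two clauses clash: one contains a literal whose negation is in the other. -/
def Clash (C D : Clause) : Prop := ∃ ℓ ∈ C, Lit.neg ℓ ∈ D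

/-- A formula is hitting if every pair of distinct clauses clashes. -/
def Hitting (F : CNF) : Prop := ∀ C ∈ F, ∀ D ∈ F, C ≠ D → Clash C D

/-- The set of variables occurring in a CNF formula. -/
def cnfVars (F : CNF) : Finset ℕ := F.sup fun C => C.image Prod.fst

/-- `D` is the resolvent of `C₁` and `C₂` (on the unique clashing literal `ℓ`). -/
def Resolvent (C₁ C₂ D : Clause) : Prop :=
  ∃ ℓ : Lit, C₁ ∩ C₂.image Lit.neg = {ℓ} ∧ D = (C₁ ∪ C₂) \ {ℓ, Lit.neg ℓ}

/-- `L` is a resolution refutation of `F`: every clause of the sequence is an axiom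
(clause of `F`) or a resolvent of two earlier clauses, and the last clause is empty. -/
def IsRefutation (F : CNF) (L : List Clause) : Prop :=
  L ≠ [] ∧ L.getLast? = some (∅ : Clause) ∧
    ∀ i < L.length, L.getD i ∅ ∈ F ∨
      ∃ j k, j < i ∧ k < i ∧ Resolvent (L.getD j ∅) (L.getD k ∅) (L.getD i ∅)

/-- Resolution hardness: the minimum length of a resolution refutation. -/
noncomputable def hardness (F : CNF) : ℕ :=
  sInf {n | ∃ L : List Clause, IsRefutation F L ∧ L.length = n}

/-- The restriction `F[¬C]`: the result of setting all literals of `C` to 0 in `F`. -/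
def restrictByNegC (F : CNF) (C : Clause) : CNF :=
  (F.filter fun D => ∀ ℓ ∈ C, Lit.neg ℓ ∉ D).image fun D => D \ C

/-- `C` is a clause interpolant of `(F, H)`: `F ⊨ C` and `{C} ∪ H` is unsatisfiable. -/
def ClauseInterpolant (C : Clause) (F H : CNF) : Prop :=
  C.NonTaut ∧ Entails F {C} ∧ Unsat (insert C H)

/-- `F` is a factor of `G`: a subset of `G` logically equivalent to a single clause. -/
def IsFactor (F G : CNF) : Prop :=
  F ⊆ G ∧ ∃ C : Clause, C.NonTaut ∧ Equivalent F {C}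

/-- `F` is a pseudo-factor of `G`: `(F, G \ F)` has a clause interpolant. -/
def IsPseudoFactor (F G : CNF) : Prop :=
  F ⊆ G ∧ ∃ C : Clause, ClauseInterpolant C F (G \ F)

/-- `G` is irreducible: every factor has size 1 or `|G|`. -/
def CNF.Irreducible (G : CNF) : Prop :=
  ∀ F : CNF, IsFactor F G → F.card = 1 ∨ F.card = G.card

/-- `G` is strongly irreducible: every pseudo-factor has size 1 or `|G|`. -/
def StronglyIrreducible (G : CNF) : Prop :=
  ∀ F : CNF, IsPseudoFactor F G → F.card = 1 ∨ F.card = G.card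

/-- `F` is minimally unsatisfiable: unsatisfiable, but every proper subset is satisfiable. -/
def MinimallyUnsat (F : CNF) : Prop :=
  Unsat F ∧ ∀ G : CNF, G ⊂ F → ∃ τ : ℕ → Bool, SatCNF τ G

/-- Every clause of `L` lies in `F` or is a resolvent of two clauses preceding it in `L`. -/
def IsDerivation (F : CNF) (L : List Clause) : Prop :=
  ∀ i < L.length, L.getD i ∅ ∈ F ∨
    ∃ j k, j < i ∧ k < i ∧ Resolvent (L.getD j ∅) (L.getD k ∅) (L.getD i ∅)

theorem IsDerivation.nil (F : CNF) : IsDerivation F [] := by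
  intro i hi
  simp at hi

theorem isDerivation_concat {F : CNF} {L : List Clause} {D : Clause} :
    IsDerivation F (L ++ [D]) ↔
      IsDerivation F L ∧ (D ∈ F ∨ ∃ A ∈ L, ∃ B ∈ L, Resolvent A B D) := by
  have hold : ∀ i < L.length, (L ++ [D]).getD i ∅ = L.getD i ∅ := fun i hi =>
    List.getD_append _ _ _ _ hi
  have hnew : (L ++ [D]).getD L.length ∅ = D := by
    simp [List.getD]
  constructor
  · intro h
    refine ⟨fun i hi => ?_, ?_⟩
    · rcases h i (by simp; omega) with h1 | ⟨j, k, hj, hk, hr⟩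
      · exact Or.inl (hold i hi ▸ h1)
      · refine Or.inr ⟨j, k, hj, hk, ?_⟩
        rwa [hold i hi, hold j (hj.trans hi), hold k (hk.trans hi)] at hr
    · rcases h L.length (by simp) with h1 | ⟨j, k, hj, hk, hr⟩
      · exact Or.inl (hnew ▸ h1)
      · rw [hnew, hold j hj, hold k hk, List.getD_eq_getElem _ _ hj,
          List.getD_eq_getElem _ _ hk] at hr
        exact Or.inr ⟨_, List.getElem_mem hj, _, List.getElem_mem hk, hr⟩
  · rintro ⟨hL, hD⟩ i hi
    have hi' : i < L.length ∨ i = L.length := by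
      simp at hi
      omega
    rcases hi' with hi' | rfl
    · rcases hL i hi' with h1 | ⟨j, k, hj, hk, hr⟩
      · exact Or.inl ((hold i hi').symm ▸ h1)
      · refine Or.inr ⟨j, k, hj, hk, ?_⟩
        rwa [hold i hi', hold j (hj.trans hi'), hold k (hk.trans hi')]
    · rw [hnew]
      refine hD.imp_right ?_
      rintro ⟨A, hA, B, hB, hr⟩
      obtain ⟨j, hj, rfl⟩ := List.getElem_of_mem hA
      obtain ⟨k, hk, rfl⟩ := List.getElem_of_mem hB
      refine ⟨j, k, hj, hk, ?_⟩
      rwa [hold j hj, hold k hk, List.getD_eq_getElem _ _ hj, List.getD_eq_getElem _ _ hk]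

theorem isRefutation_iff {F : CNF} {L : List Clause} :
    IsRefutation F L ↔ (∃ M, L = M ++ [∅]) ∧ IsDerivation F L := by
  unfold IsRefutation
  constructor
  · rintro ⟨-, hlast, h⟩
    obtain ⟨M, hM⟩ := List.getLast?_eq_some_iff.1 hlast
    exact ⟨⟨M, hM⟩, h⟩
  · rintro ⟨⟨M, rfl⟩, h⟩
    exact ⟨by simp, by simp, h⟩

theorem IsDerivation.append {F : CNF} {L M : List Clause} (hL : IsDerivation F L)
    (hM : IsDerivation F M) : IsDerivation F (L ++ M) := by
  induction M using List.reverseRecOn with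
  | nil => simpa using hL
  | append_singleton M D ih =>
    rw [isDerivation_concat] at hM
    rw [← List.append_assoc, isDerivation_concat]
    refine ⟨ih hM.1, hM.2.imp_right ?_⟩
    rintro ⟨A, hA, B, hB, hr⟩
    exact ⟨A, List.mem_append_right _ hA, B, List.mem_append_right _ hB, hr⟩

/-- Clauses derived by resolution from `F`. -/
def Derivable (F : CNF) (D : Clause) : Prop :=
  ∃ L : List Clause, IsDerivation F (L ++ [D])

theorem Derivable.of_mem {F : CNF} {D : Clause} (h : D ∈ F) : Derivable F D :=
  ⟨[], isDerivation_concat.2 ⟨IsDerivation.nil F, Or.inl h⟩⟩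

theorem Derivable.resolvent {F : CNF} {A B D : Clause} (hA : Derivable F A)
    (hB : Derivable F B) (h : Resolvent A B D) : Derivable F D := by
  obtain ⟨L, hL⟩ := hA
  obtain ⟨M, hM⟩ := hB
  exact ⟨_, isDerivation_concat.2 ⟨hL.append hM, Or.inr ⟨A, by simp, B, by simp, h⟩⟩⟩

/-- Two clauses mentioning `x` that are falsified by assignments differing only at `x` can be
resolved on `x`. -/
theorem resolvent_of_falsified {τ : ℕ → Bool} {x : ℕ} {A B : Clause}
    (hA : ¬ SatClause (Function.update τ x false) A) (hxA : (x, true) ∈ A)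
    (hB : ¬ SatClause (Function.update τ x true) B) (hxB : (x, false) ∈ B) :
    Resolvent A B ((A ∪ B) \ {(x, true), (x, false)}) := by
  refine ⟨(x, true), ?_, rfl⟩
  ext ⟨y, b⟩
  simp only [Finset.mem_inter, Finset.mem_image, Finset.mem_singleton]
  constructor
  · rintro ⟨h1, ⟨z, c⟩, h2, h3⟩
    simp only [Lit.neg, Prod.mk.injEq] at h3
    obtain ⟨rfl, rfl⟩ := h3
    simp only [SatClause, SatLit, not_exists, not_and] at hA hB
    have h4 := hA _ h1
    have h5 := hB _ h2
    by_cases hz : z = x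
    · subst hz
      simp at h5
      simp [h5]
    · simp [hz] at h4 h5
      exact absurd h4 h5
  · rintro h
    obtain ⟨rfl, rfl⟩ := Prod.mk.inj h
    exact ⟨hxA, _, hxB, rfl⟩

theorem exists_derivable_falsified {F : CNF} (hF : Unsat F) (S T : Finset ℕ)
    (hST : cnfVars F ⊆ S ∪ T) (τ : ℕ → Bool) :
    ∃ D, Derivable F D ∧ ¬ SatClause τ D ∧ ∀ ℓ ∈ D, ℓ.1 ∈ S := by
  induction T using Finset.induction_on generalizing S τ with
  | empty =>
    simp only [Unsat, SatCNF, not_exists, not_forall] at hF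
    obtain ⟨D, hD, hsat⟩ := hF τ
    refine ⟨D, .of_mem hD, hsat, fun ℓ hℓ => ?_⟩
    have : ℓ.1 ∈ cnfVars F :=
      Finset.mem_sup.2 ⟨D, hD, Finset.mem_image_of_mem _ hℓ⟩
    simpa using hST this
  | insert x T hx ih =>
    have hST' : cnfVars F ⊆ insert x S ∪ T := by
      rwa [Finset.insert_union, ← Finset.union_insert]
    have unmentioned : ∀ (b : Bool) (D : Clause), ¬ SatClause (Function.update τ x b) D →
        (x, !b) ∉ D → (∀ ℓ ∈ D, ℓ.1 ∈ insert x S) →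
        ¬ SatClause τ D ∧ ∀ ℓ ∈ D, ℓ.1 ∈ S := by
      intro b D hD hxD hS
      simp only [SatClause, SatLit, not_exists, not_and] at hD ⊢
      have hne : ∀ ℓ ∈ D, ℓ.1 ≠ x := by
        rintro ⟨y, c⟩ hℓ hy
        obtain rfl : y = x := hy
        have := hD _ hℓ
        simp at this
        have hc : c = !b := by cases b <;> cases c <;> simp_all
        exact hxD (hc ▸ hℓ)
      refine ⟨fun ℓ hℓ => ?_, fun ℓ hℓ => (Finset.mem_insert.1 (hS ℓ hℓ)).resolve_left (hne ℓ hℓ)⟩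
      simpa [Function.update_of_ne (hne ℓ hℓ)] using hD ℓ hℓ
    obtain ⟨A, hA, hfA, hSA⟩ := ih (insert x S) hST' (Function.update τ x false)
    obtain ⟨B, hB, hfB, hSB⟩ := ih (insert x S) hST' (Function.update τ x true)
    by_cases hxA : (x, true) ∈ A
    swap
    · exact ⟨A, hA, unmentioned _ A hfA hxA hSA⟩
    by_cases hxB : (x, false) ∈ B
    swap
    · exact ⟨B, hB, unmentioned _ B hfB hxB hSB⟩
    have hne : ∀ ℓ ∈ (A ∪ B) \ {((x, true) : Lit), (x, false)}, ℓ.1 ≠ x := by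
      rintro ⟨y, c⟩ hℓ hy
      obtain rfl : y = x := hy
      cases c <;> simp at hℓ
    refine ⟨_, hA.resolvent hB (resolvent_of_falsified hfA hxA hfB hxB), ?_, fun ℓ hℓ => ?_⟩
    · rintro ⟨ℓ, hℓ, hsat⟩
      have hx := hne ℓ hℓ
      rcases Finset.mem_union.1 (Finset.mem_sdiff.1 hℓ).1 with h | h
      · exact hfA ⟨ℓ, h, by simpa [SatLit, Function.update_of_ne hx] using hsat⟩
      · exact hfB ⟨ℓ, h, by simpa [SatLit, Function.update_of_ne hx] using hsat⟩
    · have hx := hne ℓ hℓ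
      rcases Finset.mem_union.1 (Finset.mem_sdiff.1 hℓ).1 with h | h
      · exact (Finset.mem_insert.1 (hSA ℓ h)).resolve_left hx
      · exact (Finset.mem_insert.1 (hSB ℓ h)).resolve_left hx

/-- Completeness of resolution. -/
theorem Unsat.exists_isRefutation {F : CNF} (hF : Unsat F) : ∃ L, IsRefutation F L := by
  obtain ⟨D, ⟨L, hL⟩, -, hS⟩ :=
    exists_derivable_falsified hF ∅ (cnfVars F) (by simp) (fun _ => true)
  obtain rfl : D = ∅ := Finset.eq_empty_of_forall_notMem fun ℓ hℓ => by simpa using hS ℓ hℓ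
  exact ⟨_, isRefutation_iff.2 ⟨⟨L, rfl⟩, hL⟩⟩

theorem Unsat.exists_isRefutation_length_eq_hardness {F : CNF} (hF : Unsat F) :
    ∃ L, IsRefutation F L ∧ L.length = hardness F := by
  obtain ⟨L, hL⟩ := hF.exists_isRefutation
  exact Nat.sInf_mem (s := {n | ∃ L : List Clause, IsRefutation F L ∧ L.length = n})
    ⟨_, L, hL, rfl⟩

theorem Lit.neg_neg (ℓ : Lit) : Lit.neg (Lit.neg ℓ) = ℓ := by
  simp [Lit.neg]

theorem mem_image_neg {C : Clause} {ℓ : Lit} : ℓ ∈ C.image Lit.neg ↔ Lit.neg ℓ ∈ C := by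
  rw [Finset.mem_image]
  exact ⟨fun ⟨m, hm, h⟩ => h ▸ (Lit.neg_neg m).symm ▸ hm, fun h => ⟨_, h, Lit.neg_neg ℓ⟩⟩

/-- The assignment agreeing with `τ` except that it falsifies all literals of `C`. -/
def overrideFalse (C : Clause) (τ : ℕ → Bool) : ℕ → Bool := fun x =>
  if (x, true) ∈ C then false else if (x, false) ∈ C then true else τ x

theorem not_satClause_overrideFalse {C : Clause} (hC : C.NonTaut) (τ : ℕ → Bool) :
    ¬ SatClause (overrideFalse C τ) C := by
  rintro ⟨⟨x, b⟩, hx, hsat⟩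
  have := hC _ hx
  cases b <;> simp_all [SatLit, overrideFalse, Lit.neg]

theorem satLit_overrideFalse_iff {C : Clause} {τ : ℕ → Bool} {ℓ : Lit} (h : ℓ ∉ C)
    (h' : Lit.neg ℓ ∉ C) : SatLit (overrideFalse C τ) ℓ ↔ SatLit τ ℓ := by
  obtain ⟨x, b⟩ := ℓ
  cases b <;> simp_all [SatLit, overrideFalse, Lit.neg]

/-- A non-tautological clause entailed by `C` contains `C`. -/
theorem subset_of_entails {C D : Clause} (hD : D.NonTaut)
    (h : ∀ τ, SatClause τ C → SatClause τ D) : C ⊆ D := by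
  intro ℓ hℓ
  by_contra hn
  refine not_satClause_overrideFalse hD (fun _ => ℓ.2) (h _ ⟨ℓ, hℓ, ?_⟩)
  obtain ⟨x, b⟩ := ℓ
  cases b <;> simp_all [SatLit, overrideFalse]

theorem satCNF_singleton {τ : ℕ → Bool} {C : Clause} : SatCNF τ {C} ↔ SatClause τ C := by
  simp [SatCNF]

theorem mem_restrictByNegC {F : CNF} {C E : Clause} :
    E ∈ restrictByNegC F C ↔ ∃ D ∈ F, (∀ ℓ ∈ C, Lit.neg ℓ ∉ D) ∧ D \ C = E := by
  simp [restrictByNegC, and_assoc]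

theorem unsat_restrictByNegC {F : CNF} {C : Clause} (hC : C.NonTaut) (h : Entails F {C}) :
    Unsat (restrictByNegC F C) := by
  rintro ⟨τ, hτ⟩
  refine not_satClause_overrideFalse hC τ (satCNF_singleton.1 (h _ fun D hD => ?_))
  by_cases hDC : ∀ ℓ ∈ C, Lit.neg ℓ ∉ D
  · obtain ⟨ℓ, hℓ, hsat⟩ := hτ _ (mem_restrictByNegC.2 ⟨D, hD, hDC, rfl⟩)
    rw [Finset.mem_sdiff] at hℓ
    refine ⟨ℓ, hℓ.1, (satLit_overrideFalse_iff hℓ.2 fun hn => hDC _ hn ?_).2 hsat⟩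
    rw [Lit.neg_neg]
    exact hℓ.1
  · push Not at hDC
    obtain ⟨⟨x, b⟩, hℓ, hℓD⟩ := hDC
    have hn : ∀ c, ((x, c) : Lit) ∈ C → c = b := by
      intro c hc
      by_contra hcb
      refine hC _ hℓ ?_
      have : c = !b := by cases b <;> cases c <;> simp_all
      simpa [Lit.neg, ← this] using hc
    refine ⟨_, hℓD, ?_⟩
    have := hC _ hℓ
    cases b <;> simp_all [SatLit, overrideFalse, Lit.neg]

theorem unsat_insert_sdiff {F G : CNF} {C : Clause} (hG : Unsat G) (h : Entails {C} F) :
    Unsat (insert C (G \ F)) := by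
  rintro ⟨τ, hτ⟩
  refine hG ⟨τ, fun D hD => ?_⟩
  by_cases hDF : D ∈ F
  · exact h τ (satCNF_singleton.2 (hτ C (Finset.mem_insert_self _ _))) D hDF
  · exact hτ D (Finset.mem_insert_of_mem (Finset.mem_sdiff.2 ⟨hD, hDF⟩))

theorem Resolvent.union {C A B D : Clause} (hC : C.NonTaut) (hA : ¬ Clash A C)
    (hB : ¬ Clash B C) (hAC : Disjoint A C) (h : Resolvent A B D) :
    Resolvent (A ∪ C) (B ∪ C) (D ∪ C) := by
  obtain ⟨ℓ, hℓ, rfl⟩ := h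
  simp only [Clash, not_exists, not_and] at hA hB
  have hm : ∀ m, m ∈ A ∧ Lit.neg m ∈ B ↔ m = ℓ := fun m => by
    rw [← mem_image_neg, ← Finset.mem_inter, hℓ, Finset.mem_singleton]
  have hℓA : ℓ ∈ A := ((hm ℓ).2 rfl).1
  have hℓC : ℓ ∉ C := Finset.disjoint_left.1 hAC hℓA
  have hnC : Lit.neg ℓ ∉ C := hA ℓ hℓA
  refine ⟨ℓ, ?_, ?_⟩
  · ext m
    rw [Finset.mem_inter, mem_image_neg, Finset.mem_union, Finset.mem_union,
      Finset.mem_singleton, ← hm m]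
    constructor
    · rintro ⟨h1 | h1, h2 | h2⟩
      · exact ⟨h1, h2⟩
      · exact absurd h2 (hA m h1)
      · exact absurd h1 (Lit.neg_neg m ▸ hB _ h2)
      · exact absurd h2 (hC m h1)
    · exact fun h => ⟨Or.inl h.1, Or.inl h.2⟩
  · ext m
    simp only [Finset.mem_union, Finset.mem_sdiff, Finset.mem_insert, Finset.mem_singleton]
    have h1 : m ∈ C → m ≠ ℓ := by
      rintro h rfl
      exact hℓC h
    have h2 : m ∈ C → m ≠ Lit.neg ℓ := by
      rintro h rfl
      exact hnC h
    tauto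

/-- A derivation from clauses having no variable in common with `C` stays a derivation when `C`
is added to all of its clauses. -/
theorem IsDerivation.map_union {F' F : CNF} {C : Clause} (hC : C.NonTaut)
    (hF : ∀ E ∈ F', E ∪ C ∈ F ∧ ¬ Clash E C ∧ Disjoint E C) {L : List Clause}
    (hL : IsDerivation F' L) :
    IsDerivation F (L.map (· ∪ C)) ∧ ∀ E ∈ L, ¬ Clash E C ∧ Disjoint E C := by
  induction L using List.reverseRecOn with
  | nil => exact ⟨IsDerivation.nil F, by simp⟩
  | append_singleton L D ih =>
    rw [isDerivation_concat] at hL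
    obtain ⟨ih1, ih2⟩ := ih hL.1
    rw [List.map_append, List.map_singleton, isDerivation_concat]
    rcases hL.2 with hD | ⟨A, hA, B, hB, hr⟩
    · refine ⟨⟨ih1, Or.inl (hF D hD).1⟩, fun E hE => ?_⟩
      rcases List.mem_append.1 hE with h | h
      · exact ih2 E h
      · exact List.mem_singleton.1 h ▸ (hF D hD).2
    · refine ⟨⟨ih1, Or.inr ⟨_, List.mem_map_of_mem hA, _, List.mem_map_of_mem hB,
        hr.union hC (ih2 A hA).1 (ih2 B hB).1 (ih2 A hA).2⟩⟩, fun E hE => ?_⟩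
      rcases List.mem_append.1 hE with h | h
      · exact ih2 E h
      · obtain rfl := List.mem_singleton.1 h
        obtain ⟨ℓ, -, rfl⟩ := hr
        refine ⟨?_, Disjoint.mono_left Finset.sdiff_subset
          (Finset.disjoint_union_left.2 ⟨(ih2 A hA).2, (ih2 B hB).2⟩)⟩
        rintro ⟨m, hm, hmC⟩
        rcases Finset.mem_union.1 (Finset.mem_sdiff.1 hm).1 with h | h
        · exact (ih2 A hA).1 ⟨m, h, hmC⟩
        · exact (ih2 B hB).1 ⟨m, h, hmC⟩

/-- The initial clause `C` of a derivation can be replaced by a derivation of `C`. -/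
theorem IsDerivation.append_filter_ne {F G : CNF} {C : Clause} {L M : List Clause}
    (hL : IsDerivation G L) (hCL : C ∈ L) (hF : F ⊆ insert C G) (hM : IsDerivation F M) :
    IsDerivation G (L ++ M.filter (· ≠ C)) := by
  induction M using List.reverseRecOn with
  | nil => simpa using hL
  | append_singleton M D ih =>
    rw [isDerivation_concat] at hM
    by_cases hD : D = C
    · simpa [List.filter_append, hD] using ih hM.1
    · have heq : (M ++ [D]).filter (· ≠ C) = M.filter (· ≠ C) ++ [D] := by
        simp [List.filter_append, hD]
      have hmem : ∀ A ∈ M, A ∈ L ++ M.filter (· ≠ C) := by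
        intro A hA
        by_cases h : A = C
        · exact List.mem_append_left _ (h ▸ hCL)
        · exact List.mem_append_right _ (List.mem_filter.2 ⟨hA, by simpa using h⟩)
      rw [heq, ← List.append_assoc, isDerivation_concat]
      refine ⟨ih hM.1, hM.2.imp (fun h => (Finset.mem_insert.1 (hF h)).resolve_left hD) ?_⟩
      rintro ⟨A, hA, B, hB, hr⟩
      exact ⟨A, hmem A hA, B, hmem B hB, hr⟩

theorem IsDerivation.of_notMem {F G : CNF} {C : Clause} {M : List Clause}
    (hF : F ⊆ insert C G) (hM : IsDerivation F M) (hCM : C ∉ M) : IsDerivation G M := by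
  induction M using List.reverseRecOn with
  | nil => exact IsDerivation.nil G
  | append_singleton M D ih =>
    rw [isDerivation_concat] at hM ⊢
    simp only [List.mem_append, List.mem_singleton, not_or] at hCM
    exact ⟨ih hM.1 hCM.1, hM.2.imp_left fun h =>
      (Finset.mem_insert.1 (hF h)).resolve_left (Ne.symm hCM.2)⟩

/-- if `G` is unsatisfiable and `F ⊆ G` is a factor of `G` with basis `C`,
then `G` has a resolution refutation of length at most
`h(F[¬C]) + h({C} ∪ (G \ F)) − 1`. -/
theorem hardness_bound_factor (G F : CNF) (C : Clause)
    (hwf : G.WellFormed) (hunsat : Unsat G) (hFG : F ⊆ G)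
    (hC : C.NonTaut) (hbasis : Equivalent F {C}) :
    ∃ L : List Clause, IsRefutation G L ∧
      L.length ≤ hardness (restrictByNegC F C) + hardness (insert C (G \ F)) - 1 := by
  have hsub : ∀ D ∈ F, C ⊆ D := fun D hD =>
    subset_of_entails (hwf D (hFG hD)) fun τ hτ => hbasis.2 τ (satCNF_singleton.2 hτ) D hD
  obtain ⟨L, hL, hLlen⟩ :=
    (unsat_restrictByNegC hC hbasis.1).exists_isRefutation_length_eq_hardness
  obtain ⟨M, hM, hMlen⟩ :=
    (unsat_insert_sdiff hunsat hbasis.2).exists_isRefutation_length_eq_hardness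
  rw [← hLlen, ← hMlen]
  rw [isRefutation_iff] at hL hM
  obtain ⟨⟨L, rfl⟩, hL⟩ := hL
  obtain ⟨⟨M, rfl⟩, hM⟩ := hM
  have hlift : IsDerivation G ((L ++ [∅]).map (· ∪ C)) := by
    refine (hL.map_union hC fun E hE => ?_).1
    obtain ⟨D, hD, hDC, rfl⟩ := mem_restrictByNegC.1 hE
    refine ⟨?_, ?_, Finset.sdiff_disjoint⟩
    · rw [Finset.sdiff_union_of_subset (hsub D hD)]
      exact hFG hD
    · rintro ⟨ℓ, hℓ, hn⟩
      exact hDC _ hn (by simpa [Lit.neg_neg] using (Finset.mem_sdiff.1 hℓ).1)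
  have hins : insert C (G \ F) ⊆ insert C G :=
    Finset.insert_subset_insert _ Finset.sdiff_subset
  by_cases hCM : C ∈ M ++ [∅]
  swap
  · refine ⟨_, isRefutation_iff.2 ⟨⟨M, rfl⟩, hM.of_notMem hins hCM⟩, ?_⟩
    simp
  by_cases hC0 : C = ∅
  · subst hC0
    refine ⟨_, isRefutation_iff.2 ⟨⟨L.map (· ∪ ∅), by simp⟩, hlift⟩, ?_⟩
    simp
  · have hlen : ((M ++ [∅]).filter (· ≠ C)).length < (M ++ [∅]).length :=
      List.length_filter_lt_length_iff_exists.2 ⟨C, hCM, by simp⟩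
    refine ⟨_, isRefutation_iff.2 ⟨⟨(L ++ [∅]).map (· ∪ C) ++ M.filter (· ≠ C), ?_⟩,
      hlift.append_filter_ne (by simp) hins hM⟩, ?_⟩
    · simp [List.filter_append, Ne.symm hC0]
    · rw [List.length_append, List.length_map]
      omega
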